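/- Let R be a local one-dimensional Mori domain (the unique maximal ideal M is nonzero, every nonzero prime ideal equals M, and R satisfies the ascending chain condition on integral divisorial ideals). Then the following are equivalent: (i) R is Clifford regular; (ii) R is stable; (iii) R is Boole regular. -/

import Mathlib

open scoped Pointwise

section Defs

variable (A K : Type*) [CommRing A] [Field K] [Algebra A K]

/-- `I` is a nonzero fractional ideal of `A` (inside `K`):
`I ≠ 0` and `dI ⊆ A` for some nonzero `d ∈ A`. -/
def IsFrac (I : Submodule A K) : Prop :=
  I ≠ ⊥ ∧ ∃ d : A, d ≠ 0 ∧ ∀ x ∈ I, ∃ a : A, algebraMap A K d * x = algebraMap A K a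

/-- The divisorial closure `I^v = (A : (A : I))`; here `(J : I) = J / I` and
`(1 : Submodule A K)` is the image of `A` in `K`. -/
def vS (I : Submodule A K) : Submodule A K := 1 / (1 / I)

/-- The `t`-operation `I^t = ⋃ {J^v : J ⊆ I nonzero finitely generated}` (a directed union,
hence equal to the supremum of submodules). -/
def tS (I : Submodule A K) : Submodule A K :=
  ⨆ J ∈ {J : Submodule A K | J ≠ ⊥ ∧ J.FG ∧ J ≤ I}, vS A K J

/-- The image of an integral ideal of `A` in `K`. -/
def idealK (I : Ideal A) : Submodule A K := Submodule.map (Algebra.linearMap A K) I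

/-- A nonzero (fractional) ideal `I` is stable if `I((I:I):I) = (I:I)`. -/
def IsStableIdeal (I : Submodule A K) : Prop := I * ((I / I) / I) = I / I

/-- `A` is a stable domain: every nonzero (fractional) ideal is stable. -/
def StableDomain : Prop := ∀ I : Submodule A K, IsFrac A K I → IsStableIdeal A K I

/-- `A` is Clifford regular: every nonzero (fractional) ideal `I` satisfies `I = I²J`
for some nonzero `A`-submodule `J` of `K`. -/
def CliffordRegularDomain : Prop :=
  ∀ I : Submodule A K, IsFrac A K I → ∃ J : Submodule A K, J ≠ ⊥ ∧ I = I * I * J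

end Defs


section Semilocal

theorem Ideal.finite_setOf_isMaximal_of_isArtinianRing_quotient {T : Type*} [CommRing T]
    (N : Ideal T) [IsArtinianRing (T ⧸ N)] (hN : ∀ P : Ideal T, P.IsMaximal → N ≤ P) :
    {P : Ideal T | P.IsMaximal}.Finite := by
  refine ((IsArtinianRing.setOfPred_isMaximal_finite (T ⧸ N)).image
    (Ideal.comap (Ideal.Quotient.mk N))).subset fun P hP => ?_
  have hsurj := Ideal.Quotient.mk_surjective (I := N)
  have hcomap : (P.map (Ideal.Quotient.mk N)).comap (Ideal.Quotient.mk N) = P := by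
    rw [Ideal.comap_map_of_surjective _ hsurj, ← RingHom.ker_eq_comap_bot, Ideal.mk_ker]
    exact sup_eq_left.2 (hN P hP)
  refine ⟨_, ?_, hcomap⟩
  refine (Ideal.map_eq_top_or_isMaximal_of_surjective _ hsurj hP).resolve_left fun h => ?_
  rw [h, Ideal.comap_top] at hcomap
  exact hP.ne_top hcomap.symm

theorem Module.IsTorsionBySet.isArtinian {R Q : Type*} [CommRing R] [AddCommGroup Q] [Module R Q]
    [Module.Finite R Q] (M : Ideal R) [M.IsMaximal] (htors : Module.IsTorsionBySet R Q M) :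
    IsArtinian R Q := by
  let _ : Module (R ⧸ M) Q := htors.module
  let _ : Field (R ⧸ M) := Ideal.Quotient.field M
  have : IsScalarTower R (R ⧸ M) Q := htors.isScalarTower
  have : Module.Finite (R ⧸ M) Q := Module.Finite.of_restrictScalars_finite R _ _
  exact isArtinian_of_surjective_algebraMap (R := R ⧸ M) Ideal.Quotient.mk_surjective

/-- A ring is semilocal if it has a module which is finite over a subring, faithful modulo the
extension of a maximal ideal `M` of the subring, and `M` extends into every maximal ideal. -/
theorem Ideal.finite_setOf_isMaximal_of_module_finite {R T F : Type*} [CommRing R] [CommRing T]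
    [Algebra R T] [AddCommGroup F] [Module R F] [Module T F] [IsScalarTower R T F]
    [Module.Finite R F] (M : Ideal R) [M.IsMaximal]
    (hann : ∀ t : T, (∀ f : F, t • f ∈ M.map (algebraMap R T) • (⊤ : Submodule T F)) →
      t ∈ M.map (algebraMap R T))
    (hmax : ∀ P : Ideal T, P.IsMaximal → M.map (algebraMap R T) ≤ P) :
    {P : Ideal T | P.IsMaximal}.Finite := by
  set N := M.map (algebraMap R T)
  let Q := F ⧸ (N • ⊤ : Submodule T F)
  have htors : Module.IsTorsionBySet R Q M := by
    rintro q ⟨m, hm⟩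
    obtain ⟨f, rfl⟩ := Submodule.Quotient.mk_surjective _ q
    change m • Submodule.Quotient.mk f = _
    rw [← Submodule.Quotient.mk_smul, Submodule.Quotient.mk_eq_zero, ← algebraMap_smul T m f]
    exact Submodule.smul_mem_smul (Ideal.mem_map_of_mem _ hm) trivial
  have : Module.Finite R Q :=
    Module.Finite.of_surjective ((Submodule.mkQ (N • ⊤ : Submodule T F)).restrictScalars R)
      (Submodule.mkQ_surjective (N • ⊤ : Submodule T F))
  have : IsArtinian T Q := isArtinian_of_tower R (htors.isArtinian M)
  obtain ⟨n, s, hs⟩ := Module.Finite.exists_fin (R := R) (M := F)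
  let g : T →ₗ[T] (Fin n → Q) := LinearMap.toSpanSingleton T _ fun i => Submodule.Quotient.mk (s i)
  have hker : LinearMap.ker g ≤ N := by
    intro t ht
    refine hann t fun f => ?_
    have hf : f ∈ Submodule.span R (Set.range s) := hs ▸ trivial
    induction hf using Submodule.span_induction with
    | mem x hx =>
      obtain ⟨i, rfl⟩ := hx
      have := congrFun (LinearMap.mem_ker.1 ht) i
      exact (Submodule.Quotient.mk_eq_zero _).1 this
    | zero => simp
    | add x y _ _ hx hy => rw [smul_add]; exact add_mem hx hy
    | smul r x _ hx =>
      rw [← algebraMap_smul T r x, smul_comm]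
      exact Submodule.smul_mem _ _ hx
  have : IsArtinian T (T ⧸ LinearMap.ker g) :=
    isArtinian_of_injective (g.quotKerEquivRange.toLinearMap) g.quotKerEquivRange.injective
  have : IsArtinian T (T ⧸ N) :=
    isArtinian_of_surjective _ (Submodule.factor hker) (Submodule.factor_surjective hker)
  have : IsArtinianRing (T ⧸ N) := isArtinian_of_tower T this
  exact Ideal.finite_setOf_isMaximal_of_isArtinianRing_quotient N hmax

end Semilocal

section Multiplier

variable {R K : Type*} [CommRing R] [Field K] [Algebra R K]

/-- The ring `(F : F)` of multipliers of a submodule, as a subalgebra. -/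
def Submodule.multiplierRing (F : Submodule R K) : Subalgebra R K where
  carrier := (F / F : Submodule R K)
  mul_mem' := fun {a b} ha hb => by
    simp only [SetLike.mem_coe, Submodule.mem_div_iff_forall_mul_mem] at *
    exact fun y hy => mul_assoc a b y ▸ ha _ (hb _ hy)
  add_mem' := fun ha hb => (F / F).add_mem ha hb
  algebraMap_mem' := fun r => by
    simp only [SetLike.mem_coe, Submodule.mem_div_iff_forall_mul_mem]
    exact fun y hy => Algebra.smul_def r y ▸ F.smul_mem r hy

theorem Submodule.mem_multiplierRing {F : Submodule R K} {x : K} :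
    x ∈ F.multiplierRing ↔ x ∈ F / F := Iff.rfl

/-- A submodule stable under a subalgebra `T`, as a `T`-submodule. -/
def Submodule.extendScalarsOfMul (T : Subalgebra R K) (N : Submodule R K)
    (hN : ∀ t ∈ T, ∀ n ∈ N, t * n ∈ N) : Submodule T K where
  carrier := N
  add_mem' := fun ha hb => N.add_mem ha hb
  zero_mem' := N.zero_mem
  smul_mem' := fun t n hn => hN t t.2 n hn

theorem Submodule.isIntegral_of_mem_div_self {F : Submodule R K} (hF : F.FG) (hF0 : F ≠ ⊥) {x : K}
    (hx : x ∈ F / F) : IsIntegral R x :=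
  isIntegral_of_smul_mem_submodule F hF0 hF x (Submodule.mem_div_iff_forall_mul_mem.1 hx)

theorem IsStableIdeal.one_mem {I : Submodule R K} (hI : IsStableIdeal R K I) :
    (1 : K) ∈ I * ((I / I) / I) := by
  rw [show I * ((I / I) / I) = I / I from hI]
  exact Submodule.one_mem_div.2 le_rfl

/-- Over a local ring, a finitely generated stable ideal `F` is principal over `(F : F)`. -/
theorem IsStableIdeal.exists_generator [IsDomain R] [IsLocalRing R] [IsFractionRing R K]
    {F : Submodule R K} (hF : F.FG) (hF0 : F ≠ ⊥) (hstab : IsStableIdeal R K F) :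
    ∃ y ∈ F, y ≠ 0 ∧ ∀ x ∈ F, x * y⁻¹ ∈ F / F := by
  set H := (F / F) / F with hH
  have hFH : ∀ f ∈ F, ∀ h ∈ H, f * h ∈ F / F := fun f hf h hh =>
    mul_comm h f ▸ Submodule.mem_div_iff_forall_mul_mem.1 hh f hf
  have h1 : (1 : K) ∈ F * H := hstab.one_mem
  set T := F.multiplierRing
  have hTint : Algebra.IsIntegral R T :=
    ⟨fun t => (isIntegral_algHom_iff T.val Subtype.val_injective).1
      (Submodule.isIntegral_of_mem_div_self hF hF0 t.2)⟩
  let F' : Submodule T K := F.extendScalarsOfMul T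
    fun t ht => Submodule.mem_div_iff_forall_mul_mem.1 ht
  let H' : Submodule T K := H.extendScalarsOfMul T fun t ht h hh =>
    Submodule.mem_div_iff_forall_mul_mem.2 fun f hf => by
      rw [mul_assoc]
      exact T.mul_mem ht (Submodule.mem_div_iff_forall_mul_mem.1 hh f hf)
  have hmul : F' * H' = 1 := by
    refine le_antisymm (Submodule.mul_le.2 fun f hf h hh => ?_) (Submodule.one_le.2 ?_)
    · exact Submodule.mem_one.2 ⟨⟨f * h, hFH f hf h hh⟩, rfl⟩
    · have : F * H ≤ (F' * H').restrictScalars R :=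
        Submodule.mul_le.2 fun f hf h hh => Submodule.mul_mem_mul (M := F') (N := H') hf hh
      exact this h1
  have hfin : {P : Ideal T | P.IsMaximal}.Finite := by
    let φ : F →ₗ[R] F' :=
      { toFun := fun x => ⟨x, x.2⟩, map_add' := fun _ _ => rfl, map_smul' := fun _ _ => rfl }
    have : Module.Finite R F := Module.Finite.iff_fg.2 hF
    have : Module.Finite R F' := Module.Finite.of_surjective φ fun x => ⟨⟨x, x.2⟩, rfl⟩
    refine Ideal.finite_setOf_isMaximal_of_module_finite (R := R) (F := F')
      (IsLocalRing.maximalIdeal R) (fun t ht => ?_) fun P hP => ?_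
    · set N := (IsLocalRing.maximalIdeal R).map (algebraMap R T)
      have key : ∀ q ∈ N • (⊤ : Submodule T F'), ∀ h ∈ H, ∃ n ∈ N, (n : K) = q * h := by
        intro q hq h hh
        induction hq using Submodule.smul_induction_on' with
        | smul n hn f _ =>
          refine ⟨n * ⟨f * h, hFH f f.2 h hh⟩, N.mul_mem_right _ hn, ?_⟩
          exact (mul_assoc (n : K) f h).symm
        | add x _ y _ hx hy =>
          obtain ⟨a, ha, hax⟩ := hx
          obtain ⟨b, hb, hby⟩ := hy
          exact ⟨a + b, N.add_mem ha hb, by simp [hax, hby, add_mul]⟩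
      have : ∀ x ∈ F * H, ∃ n ∈ N, (n : K) = t * x := by
        intro x hx
        induction hx using Submodule.mul_induction_on' with
        | mem_mul_mem f hf h hh =>
          obtain ⟨n, hn, hnf⟩ := key _ (ht ⟨f, hf⟩) h hh
          exact ⟨n, hn, hnf.trans (mul_assoc (t : K) f h)⟩
        | add x _ y _ hx hy =>
          obtain ⟨a, ha, hax⟩ := hx
          obtain ⟨b, hb, hby⟩ := hy
          exact ⟨a + b, N.add_mem ha hb, by simp [hax, hby, mul_add]⟩
      obtain ⟨n, hn, hnt⟩ := this 1 h1
      rw [mul_one] at hnt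
      exact Subtype.ext hnt ▸ hn
    · rw [Ideal.map_le_iff_le_comap]
      have := Ideal.isMaximal_comap_of_isIntegral_of_isMaximal (R := R) P
      exact (IsLocalRing.eq_maximalIdeal this).ge
  have hfrac : ∀ {A B : Submodule T K}, A * B = 1 → IsFractional (nonZeroDivisors T) A :=
    fun h => FractionalIdeal.isFractional_of_fg (Submodule.fg_of_isUnit (.of_mul_eq_one _ h))
  have hprin := FractionalIdeal.isPrincipal.of_finite_maximals_of_inv (A := K) le_rfl hfin
    ⟨F', hfrac hmul⟩ ⟨H', hfrac ((mul_comm _ _).trans hmul)⟩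
    (FractionalIdeal.coeToSubmodule_injective ((FractionalIdeal.coe_mul _ _).trans (hmul.trans FractionalIdeal.coe_one.symm)))
  obtain ⟨y, hy⟩ := hprin
  change F' = Submodule.span T {y} at hy
  have hyF : y ∈ F' := hy ▸ Submodule.mem_span_singleton_self y
  have hy0 : y ≠ 0 := by
    rintro rfl
    obtain ⟨x, hx, hx0⟩ := Submodule.exists_mem_ne_zero_of_ne_bot hF0
    have hx' : x ∈ F' := hx
    rw [hy, Submodule.span_zero_singleton] at hx'
    exact hx0 hx'
  refine ⟨y, hyF, hy0, fun x hx => ?_⟩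
  have hx' : x ∈ F' := hx
  rw [hy] at hx'
  obtain ⟨t, rfl⟩ := Submodule.mem_span_singleton.1 hx'
  rw [show t • y = (t : K) * y from rfl, mul_inv_cancel_right₀ hy0]
  exact t.2

end Multiplier

section Integral

variable {R K : Type*} [CommRing R] [Field K] [Algebra R K]

theorem IsIntegral.mem_subalgebra_of_inv_mem {T : Subalgebra R K} {w : K} (hw : IsIntegral R w)
    (hwT : w⁻¹ ∈ T) : w ∈ T := by
  by_cases hw0 : w = 0
  · exact hw0 ▸ T.zero_mem
  let S := integralClosure T K
  have hloc : IsLocalHom (algebraMap T S) :=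
    (algebraMap_isIntegral_iff.2 inferInstance).isLocalHom fun a b hab =>
      Subtype.ext (congrArg (Subtype.val : S → K) hab)
  let wS : S := ⟨w, hw.tower_top⟩
  have hu : IsUnit (algebraMap T S ⟨w⁻¹, hwT⟩) :=
    .of_mul_eq_one wS (Subtype.ext (inv_mul_cancel₀ hw0))
  obtain ⟨v, hv⟩ := (isUnit_of_map_unit _ _ hu).exists_right_inv
  have hv' : w⁻¹ * (v : K) = 1 := congrArg Subtype.val hv
  have : (v : K) = w := by rw [inv_mul_eq_one₀ hw0] at hv'; exact hv'.symm
  exact this ▸ v.2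

/-- In a one-dimensional local domain, if `z` is integral and all powers of `z⁻¹` have a common
denominator, then `z⁻¹` is integral. -/
theorem IsIntegral.inv_of_common_denominator [IsLocalRing R] [FaithfulSMul R K]
    (hdim : ∀ P : Ideal R, P.IsPrime → P ≠ ⊥ → P = IsLocalRing.maximalIdeal R)
    {z c : K} (hz : IsIntegral R z) (hz0 : z ≠ 0) (hc : c ≠ 0)
    (hden : ∀ n : ℕ, c * z⁻¹ ^ n ∈ (1 : Submodule R K)) : IsIntegral R z⁻¹ := by
  let S := integralClosure R K
  have hdenS : ∀ n : ℕ, c * z⁻¹ ^ n ∈ S := fun n => by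
    obtain ⟨r, hr⟩ := Submodule.mem_one.1 (hden n)
    exact hr ▸ S.algebraMap_mem r
  obtain ⟨r, hr⟩ := Submodule.mem_one.1 (hden 0)
  rw [pow_zero, mul_one] at hr
  have hr0 : r ≠ 0 := by rintro rfl; exact hc (by rw [← hr, map_zero])
  let zS : S := ⟨z, hz⟩
  have hpow : ∀ n, ∃ t : S, algebraMap R S r = zS ^ n * t := fun n =>
    ⟨⟨_, hdenS n⟩, Subtype.ext <| by
      change algebraMap R K r = z ^ n * (c * z⁻¹ ^ n)
      rw [hr, inv_pow, mul_left_comm, mul_inv_cancel₀ (pow_ne_zero n hz0), mul_one]⟩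
  suffices h : IsUnit zS by
    obtain ⟨v, hv⟩ := h.exists_right_inv
    have hv' : z * (v : K) = 1 := congrArg Subtype.val hv
    rw [← eq_inv_of_mul_eq_one_right hv']
    exact v.2
  by_contra hnu
  obtain ⟨P, hP, hzP⟩ := exists_max_ideal_of_mem_nonunits hnu
  have hPprime := hP.isPrime
  have hdisj : Disjoint ((Ideal.span {algebraMap R S r} : Ideal S) : Set S)
      (P.primeCompl ⊔ Submonoid.powers zS : Submonoid S) := by
    rw [Set.disjoint_left]
    rintro x hx hx'
    obtain ⟨t, rfl⟩ := Ideal.mem_span_singleton'.1 hx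
    obtain ⟨s, hs, _, ⟨n, rfl⟩, hst⟩ := Submonoid.mem_sup.1 hx'
    obtain ⟨b, hb⟩ := hpow (n + 1)
    have hzS : zS ^ n ≠ 0 := pow_ne_zero n fun h => hz0 (congrArg Subtype.val h)
    have hs' : s = zS * (t * b) := by
      apply mul_right_cancel₀ hzS
      rw [show s * zS ^ n = t * algebraMap R S r from hst, hb]
      ring
    exact hs (hs' ▸ P.mul_mem_right _ hzP)
  obtain ⟨Q, hQ, hrQ, hQd⟩ := Ideal.exists_le_prime_disjoint _ _ hdisj
  have hmem : ∀ x ∈ (P.primeCompl ⊔ Submonoid.powers zS : Submonoid S), x ∉ Q :=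
    fun x hx hxQ => Set.disjoint_left.1 hQd hxQ hx
  have hQP : Q ≤ P := fun x hx => by
    by_contra hxP
    exact hmem x ((le_sup_left : P.primeCompl ≤ _) hxP) hx
  have hzQ : zS ∉ Q := hmem _ ((le_sup_right : Submonoid.powers zS ≤ _) (Submonoid.mem_powers _))
  have hlt := Ideal.comap_lt_comap_of_integral_mem_sdiff (R := R) hQP ⟨hzP, hzQ⟩
    (Algebra.IsIntegral.isIntegral zS)
  have hQ0 : Q.comap (algebraMap R S) ≠ ⊥ := fun h => by
    have : r ∈ Q.comap (algebraMap R S) := hrQ (Ideal.mem_span_singleton_self _)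
    rw [h] at this
    exact hr0 this
  have hQM := hdim _ (Ideal.comap_isPrime (algebraMap R S) Q) hQ0
  have hPM : P.comap (algebraMap R S) = _ :=
    hdim _ (Ideal.comap_isPrime (algebraMap R S) P) fun h => not_lt_bot (h ▸ hlt)
  exact hlt.ne (hQM.trans hPM.symm)

/-- Over a one-dimensional local domain all of whose finitely generated ideals are stable, every
almost integral element is integral. -/
theorem isIntegral_of_common_denominator [IsDomain R] [IsLocalRing R] [IsFractionRing R K]
    (hdim : ∀ P : Ideal R, P.IsPrime → P ≠ ⊥ → P = IsLocalRing.maximalIdeal R)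
    (hstab : ∀ F : Submodule R K, F.FG → F ≠ ⊥ → IsStableIdeal R K F)
    {w c : K} (hc : c ≠ 0) (hden : ∀ n : ℕ, c * w ^ n ∈ (1 : Submodule R K)) :
    IsIntegral R w := by
  let G : Submodule R K := Submodule.span R {1, w}
  have h1G : (1 : K) ∈ G := Submodule.subset_span (by simp)
  have hwG : w ∈ G := Submodule.subset_span (by simp)
  have hGfg : G.FG := Submodule.fg_span (by simp)
  have hG0 : G ≠ ⊥ := Submodule.ne_bot_iff _ |>.2 ⟨1, h1G, one_ne_zero⟩
  have hadj : ∀ q ∈ Algebra.adjoin R {w}, c * q ∈ (1 : Submodule R K) := by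
    intro q hq
    rw [Algebra.adjoin_singleton_eq_range_aeval] at hq
    obtain ⟨p, rfl⟩ := hq
    change c * Polynomial.aeval w p ∈ _
    rw [Polynomial.aeval_eq_sum_range, Finset.mul_sum]
    refine Submodule.sum_mem _ fun i _ => ?_
    rw [mul_smul_comm]
    exact Submodule.smul_mem _ _ (hden i)
  have hGadj : G ≤ (Algebra.adjoin R {w}).toSubmodule := by
    refine Submodule.span_le.2 ?_
    rintro x (rfl | rfl)
    · exact (Algebra.adjoin R {w}).one_mem
    · exact Algebra.self_mem_adjoin_singleton R _
  obtain ⟨u, huG, hu0, hu⟩ := (hstab G hGfg hG0).exists_generator hGfg hG0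
  have hint : ∀ x ∈ G, IsIntegral R (x * u⁻¹) := fun x hx =>
    Submodule.isIntegral_of_mem_div_self hGfg hG0 (hu x hx)
  have hz : IsIntegral R u⁻¹ := one_mul u⁻¹ ▸ hint 1 h1G
  have hui : IsIntegral R u := by
    have := hz.inv_of_common_denominator hdim (inv_ne_zero hu0) hc fun n => by
      rw [inv_inv]
      exact hadj _ ((Algebra.adjoin R {w}).pow_mem (hGadj huG) n)
    rwa [inv_inv] at this
  have := (hint w hwG).mul hui
  rwa [inv_mul_cancel_right₀ hu0] at this

end Integral

section Clifford

variable {R K : Type*} [CommRing R] [Field K] [Algebra R K]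

theorem IsStableIdeal.of_one_mem {I J : Submodule R K} (hIJ : I = I * I * J)
    (h1 : (1 : K) ∈ I * J) : IsStableIdeal R K I := by
  have hmul : (I / I) * I ≤ I := Submodule.le_div_iff_mul_le.1 le_rfl
  refine le_antisymm ((mul_comm _ _).trans_le (Submodule.le_div_iff_mul_le.1 le_rfl)) ?_
  have hJ : J ≤ (I / I) / I := by
    rw [Submodule.le_div_iff_mul_le, Submodule.le_div_iff_mul_le, mul_assoc, mul_comm, ← hIJ]
  calc I / I ≤ (I / I) * (I * J) := by
        simpa using mul_le_mul_right (Submodule.one_le.2 h1) (I / I)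
    _ = (I / I) * I * J := (mul_assoc _ _ _).symm
    _ ≤ I * J := mul_le_mul_left hmul J
    _ ≤ I * ((I / I) / I) := mul_le_mul_right hJ I

theorem Submodule.mul_le_div_self_of_eq {I J : Submodule R K} (hIJ : I = I * I * J) :
    I * J ≤ I / I := by
  rw [Submodule.le_div_iff_mul_le, mul_right_comm, ← hIJ]

theorem Submodule.one_mem_mul_of_fg {F J : Submodule R K} (hF : F.FG) (hF0 : F ≠ ⊥)
    (hFJ : F = F * F * J) : (1 : K) ∈ F * J := by
  let T := F.multiplierRing
  have hmul : (F / F) * F ≤ F := Submodule.le_div_iff_mul_le.1 le_rfl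
  let F' : Submodule T K := F.extendScalarsOfMul T
    fun t ht => Submodule.mem_div_iff_forall_mul_mem.1 ht
  let L : Ideal T := Submodule.comap (Algebra.linearMap T K)
    ((F * J).extendScalarsOfMul T fun t ht x hx => by
      refine mul_le_mul_left hmul J ?_
      rw [mul_assoc]
      exact Submodule.mul_mem_mul ht hx)
  have hF' : F'.FG := .of_restrictScalars R hF
  have hle : F' ≤ L • F' := by
    have : F * J * F ≤ (L • F').restrictScalars R := Submodule.mul_le.2 fun l hl f hf =>
      Submodule.smul_mem_smul (I := L) (N := F') (r := ⟨l, Submodule.mul_le_div_self_of_eq hFJ hl⟩)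
        hl hf
    rw [mul_right_comm, ← hFJ] at this
    exact this
  obtain ⟨r, hr, hr0⟩ := Submodule.exists_sub_one_mem_and_smul_eq_zero_of_fg_of_le_smul L F' hF' hle
  obtain ⟨x, hx, hx0⟩ := Submodule.exists_mem_ne_zero_of_ne_bot hF0
  have hr0' : r = 0 := by
    refine Subtype.ext ((mul_eq_zero.1 ?_).resolve_right hx0)
    exact hr0 x hx
  rw [hr0', zero_sub] at hr
  have := L.neg_mem hr
  rw [neg_neg] at this
  exact this

theorem IsFrac.of_fg [IsFractionRing R K] [Nontrivial R] {F : Submodule R K} (hF : F.FG)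
    (hF0 : F ≠ ⊥) :
    IsFrac R K F := by
  obtain ⟨d, hd, h⟩ := FractionalIdeal.isFractional_of_fg (S := nonZeroDivisors R) hF
  refine ⟨hF0, d, nonZeroDivisors.ne_zero hd, fun x hx => ?_⟩
  obtain ⟨a, ha⟩ := h x hx
  exact ⟨a, by rw [ha, Algebra.smul_def]⟩

theorem CliffordRegularDomain.isStableIdeal_of_fg [IsFractionRing R K] [Nontrivial R]
    (h : CliffordRegularDomain R K) {F : Submodule R K} (hF : F.FG) (hF0 : F ≠ ⊥) :
    IsStableIdeal R K F := by
  obtain ⟨J, _, hJ⟩ := h F (.of_fg hF hF0)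
  exact .of_one_mem hJ (Submodule.one_mem_mul_of_fg hF hF0 hJ)

theorem IsFrac.exists_mul_mem_one {I : Submodule R K} [FaithfulSMul R K] (hI : IsFrac R K I) :
    ∃ d : K, d ≠ 0 ∧ ∀ x ∈ I, d * x ∈ (1 : Submodule R K) := by
  obtain ⟨-, d, hd, h⟩ := hI
  refine ⟨algebraMap R K d, by simpa using hd, fun x hx => ?_⟩
  obtain ⟨a, ha⟩ := h x hx
  exact Submodule.mem_one.2 ⟨a, ha.symm⟩

theorem Submodule.one_div_antitone {I J : Submodule R K} (h : I ≤ J) : 1 / J ≤ 1 / I := fun _ hx =>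
  Submodule.mem_div_iff_forall_mul_mem.2 fun y hy =>
    Submodule.mem_div_iff_forall_mul_mem.1 hx y (h hy)

theorem le_vS (I : Submodule R K) : I ≤ vS R K I := by
  rw [vS, Submodule.le_div_iff_mul_le, mul_comm]
  exact Submodule.le_div_iff_mul_le.1 le_rfl

theorem one_div_vS (I : Submodule R K) : 1 / vS R K I = 1 / I :=
  le_antisymm (Submodule.one_div_antitone (le_vS I)) (le_vS (1 / I))

theorem vS_vS (I : Submodule R K) : vS R K (vS R K I) = vS R K I :=
  congrArg (1 / ·) (one_div_vS I)

theorem vS_mono {I J : Submodule R K} (h : I ≤ J) : vS R K I ≤ vS R K J :=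
  Submodule.one_div_antitone (Submodule.one_div_antitone h)

theorem vS_le_one {I : Submodule R K} (h : I ≤ 1) : vS R K I ≤ 1 := fun x hx => by
  have := Submodule.mem_div_iff_forall_mul_mem.1 hx 1 (Submodule.one_le.1
    (Submodule.one_le_one_div.2 h))
  rwa [mul_one] at this

theorem idealK_comap {N : Submodule R K} (h : N ≤ 1) :
    idealK R K (N.comap (Algebra.linearMap R K)) = N := by
  rw [idealK, Submodule.map_comap_eq, ← Submodule.one_eq_range]
  exact inf_eq_right.2 h

/-- In a Mori domain, every nonzero integral ideal has the same inverse as some finitely generated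
subideal. -/
theorem exists_fg_one_div_le_of_le_one
    (hmori : ∀ f : ℕ → Ideal R, Monotone f →
      (∀ n, vS R K (idealK R K (f n)) = idealK R K (f n)) → ∃ n, ∀ m, n ≤ m → f m = f n)
    {L : Submodule R K} (hL : L ≤ 1) (hL0 : L ≠ ⊥) :
    ∃ F ≤ L, F.FG ∧ F ≠ ⊥ ∧ 1 / F ≤ 1 / L := by
  have hwf : WellFoundedGT {I : Ideal R // vS R K (idealK R K I) = idealK R K I} := by
    rw [wellFoundedGT_iff_monotone_chain_condition]
    intro a
    obtain ⟨n, hn⟩ := hmori (fun n => a n) (fun i j hij => a.monotone hij) fun n => (a n).2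
    exact ⟨n, fun m hm => Subtype.ext (hn m hm).symm⟩
  have hdiv : ∀ F ≤ L, vS R K (idealK R K ((vS R K F).comap (Algebra.linearMap R K))) =
      idealK R K ((vS R K F).comap (Algebra.linearMap R K)) := fun F hF => by
    rw [idealK_comap (vS_le_one (hF.trans hL)), vS_vS]
  let 𝒮 := {F : Submodule R K // F ≤ L ∧ F.FG ∧ F ≠ ⊥}
  let D : 𝒮 → {I : Ideal R // vS R K (idealK R K I) = idealK R K I} := fun F => ⟨_, hdiv F F.2.1⟩
  obtain ⟨x, hx, hx0⟩ := Submodule.exists_mem_ne_zero_of_ne_bot hL0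
  have hne : (Set.range D).Nonempty := ⟨_, ⟨Submodule.span R {x},
    (Submodule.span_singleton_le_iff_mem _ _).2 hx, Submodule.fg_span_singleton x,
    by simpa using hx0⟩, rfl⟩
  obtain ⟨_, ⟨⟨F, hFL, hFfg, hF0⟩, rfl⟩, hmax⟩ := hwf.wf.has_min _ hne
  refine ⟨F, hFL, hFfg, hF0, ?_⟩
  suffices h : L ≤ vS R K F from one_div_vS F ▸ Submodule.one_div_antitone h
  intro l hl
  have hGL : F ⊔ Submodule.span R {l} ≤ L :=
    sup_le hFL ((Submodule.span_singleton_le_iff_mem _ _).2 hl)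
  let G : 𝒮 := ⟨F ⊔ Submodule.span R {l}, hGL, hFfg.sup (Submodule.fg_span_singleton l),
    fun h => hF0 (le_bot_iff.1 (h ▸ le_sup_left))⟩
  have hle : D ⟨F, hFL, hFfg, hF0⟩ ≤ D G := Submodule.comap_mono (vS_mono le_sup_left)
  have heq : D ⟨F, hFL, hFfg, hF0⟩ = D G := hle.eq_of_not_lt (hmax _ ⟨G, rfl⟩)
  have hv : vS R K F = vS R K (F ⊔ Submodule.span R {l}) := by
    rw [← idealK_comap (vS_le_one (hFL.trans hL)), ← idealK_comap (vS_le_one (hGL.trans hL))]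
    exact congrArg (idealK R K) (congrArg Subtype.val heq)
  rw [hv]
  exact le_vS _ (le_sup_right (a := F) (Submodule.mem_span_singleton_self l))

/-- In a Mori domain, every fractional ideal has the same inverse as some finitely generated
fractional subideal. -/
theorem IsFrac.exists_fg_one_div_le [FaithfulSMul R K]
    (hmori : ∀ f : ℕ → Ideal R, Monotone f →
      (∀ n, vS R K (idealK R K (f n)) = idealK R K (f n)) → ∃ n, ∀ m, n ≤ m → f m = f n)
    {L : Submodule R K} (hL : IsFrac R K L) :
    ∃ F ≤ L, F.FG ∧ F ≠ ⊥ ∧ 1 / F ≤ 1 / L := by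
  obtain ⟨d, hd0, hd⟩ := hL.exists_mul_mem_one
  have hle : L.map (LinearMap.mulLeft R d) ≤ 1 := by
    rintro _ ⟨x, hx, rfl⟩
    exact hd x hx
  have hne : L.map (LinearMap.mulLeft R d) ≠ ⊥ := by
    obtain ⟨x, hx, hx0⟩ := Submodule.exists_mem_ne_zero_of_ne_bot hL.1
    exact (Submodule.ne_bot_iff _).2 ⟨d * x, ⟨x, hx, rfl⟩, mul_ne_zero hd0 hx0⟩
  obtain ⟨F, hFL, hFfg, hF0, hF⟩ := exists_fg_one_div_le_of_le_one hmori hle hne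
  refine ⟨F.map (LinearMap.mulLeft R d⁻¹), ?_, hFfg.map _, ?_, fun x hx => ?_⟩
  · rintro _ ⟨y, hy, rfl⟩
    obtain ⟨x, hx, rfl⟩ := hFL hy
    simpa [hd0] using hx
  · obtain ⟨x, hx, hx0⟩ := Submodule.exists_mem_ne_zero_of_ne_bot hF0
    exact (Submodule.ne_bot_iff _).2 ⟨d⁻¹ * x, ⟨x, hx, rfl⟩, mul_ne_zero (inv_ne_zero hd0) hx0⟩
  · have hxF : x * d⁻¹ ∈ 1 / F := Submodule.mem_div_iff_forall_mul_mem.2 fun f hf => by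
      rw [mul_assoc]
      exact Submodule.mem_div_iff_forall_mul_mem.1 hx _ ⟨f, hf, rfl⟩
    refine Submodule.mem_div_iff_forall_mul_mem.2 fun l hl => ?_
    have := Submodule.mem_div_iff_forall_mul_mem.1 (hF hxF) _ ⟨l, hl, rfl⟩
    simpa [mul_assoc, hd0] using this

/-- If `L` is idempotent, `F ≤ L` has the same inverse as `L` and `F = y (F : F)`, then `y⁻¹`
multiplies `(R : L)` into itself. -/
theorem Submodule.inv_mul_mem_one_div {F L : Submodule R K} (hLL : L * L = L) (hFL : F ≤ L)
    (hF : 1 / F ≤ 1 / L) {y : K} (hy : ∀ x ∈ F, x * y⁻¹ ∈ F / F) {q : K} (hq : q ∈ 1 / L) :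
    y⁻¹ * q ∈ 1 / L := by
  simp only [SetLike.le_def, Submodule.mem_div_iff_forall_mul_mem] at hF hy hq ⊢
  have h2 : ∀ f ∈ F, ∀ l ∈ L, y⁻¹ * q * f * l ∈ (1 : Submodule R K) :=
      fun f hf => hF fun g hg => by
    rw [show y⁻¹ * q * f * g = q * (f * y⁻¹ * g) by ring]
    exact hq _ (hFL (hy f hf g hg))
  have h3 : ∀ l ∈ L, ∀ l' ∈ L, y⁻¹ * q * l * l' ∈ (1 : Submodule R K) :=
      fun l hl => hF fun f hf => by
    rw [mul_right_comm]
    exact h2 f hf l hl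
  intro x hx
  rw [← hLL] at hx
  induction hx using Submodule.mul_induction_on' with
  | mem_mul_mem l hl l' hl' => exact mul_assoc (y⁻¹ * q) l l' ▸ h3 l hl l' hl'
  | add a _ b _ ha hb => rw [mul_add]; exact add_mem ha hb

theorem CliffordRegularDomain.stableDomain [IsDomain R] [IsLocalRing R] [IsFractionRing R K]
    (hdim : ∀ P : Ideal R, P.IsPrime → P ≠ ⊥ → P = IsLocalRing.maximalIdeal R)
    (hmori : ∀ f : ℕ → Ideal R, Monotone f →
      (∀ n, vS R K (idealK R K (f n)) = idealK R K (f n)) → ∃ n, ∀ m, n ≤ m → f m = f n)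
    (h : CliffordRegularDomain R K) : StableDomain R K := by
  intro I hI
  obtain ⟨J, hJ0, hIJ⟩ := h I hI
  refine .of_one_mem hIJ ?_
  set L := I * J with hLdef
  have hLT : L ≤ I / I := Submodule.mul_le_div_self_of_eq hIJ
  have hLL : L * L = L := by
    calc L * L = I * I * J * J := by rw [hLdef]; ring
      _ = L := by rw [← hIJ]
  obtain ⟨a, ha, ha0⟩ := Submodule.exists_mem_ne_zero_of_ne_bot hI.1
  obtain ⟨b, hb, hb0⟩ := Submodule.exists_mem_ne_zero_of_ne_bot hJ0
  have hL0 : L ≠ ⊥ :=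
    (Submodule.ne_bot_iff _).2 ⟨a * b, Submodule.mul_mem_mul ha hb, mul_ne_zero ha0 hb0⟩
  have hLfrac : IsFrac R K L := by
    obtain ⟨-, d, hd, hdI⟩ := hI
    obtain ⟨r, hr⟩ := hdI a ha
    refine ⟨hL0, r, ?_, fun x hx => ?_⟩
    · rintro rfl
      rw [map_zero] at hr
      exact mul_ne_zero (by simpa using hd) ha0 hr
    · obtain ⟨s, hs⟩ := hdI _ (Submodule.mem_div_iff_forall_mul_mem.1 (hLT hx) a ha)
      exact ⟨s, by rw [← hr, ← hs]; ring⟩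
  obtain ⟨F, hFL, hFfg, hF0, hF⟩ := hLfrac.exists_fg_one_div_le hmori
  have hstab : ∀ F : Submodule R K, F.FG → F ≠ ⊥ → IsStableIdeal R K F :=
    fun F => h.isStableIdeal_of_fg
  obtain ⟨y, hyF, hy0, hy⟩ := (hstab F hFfg hF0).exists_generator hFfg hF0
  obtain ⟨q, hq0, hq⟩ := hLfrac.exists_mul_mem_one
  obtain ⟨l, hl, hl0⟩ := Submodule.exists_mem_ne_zero_of_ne_bot hL0
  have hpow : ∀ n : ℕ, y⁻¹ ^ n * q ∈ 1 / L := fun n => by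
    induction n with
    | zero =>
      rw [pow_zero, one_mul]
      exact Submodule.mem_div_iff_forall_mul_mem.2 hq
    | succ n ih =>
      rw [pow_succ', mul_assoc]
      exact Submodule.inv_mul_mem_one_div hLL hFL hF hy ih
  have hint : IsIntegral R y⁻¹ :=
    isIntegral_of_common_denominator hdim hstab (mul_ne_zero hq0 hl0) fun n => by
      rw [show q * l * y⁻¹ ^ n = y⁻¹ ^ n * q * l by ring]
      exact Submodule.mem_div_iff_forall_mul_mem.1 (hpow n) l hl
  have hyinv : y⁻¹ ∈ I / I := hint.mem_subalgebra_of_inv_mem (T := I.multiplierRing)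
    ((inv_inv y).symm ▸ hLT (hFL hyF))
  have hle : (I / I) * L ≤ L := by
    rw [hLdef, ← mul_assoc]
    exact mul_le_mul_left (Submodule.le_div_iff_mul_le.1 le_rfl) J
  have := hle (Submodule.mul_mem_mul hyinv (hFL hyF))
  rwa [inv_mul_cancel₀ hy0] at this

theorem StableDomain.cliffordRegularDomain (h : StableDomain R K) : CliffordRegularDomain R K := by
  intro I hI
  have hmul : (I / I) * I = I := le_antisymm (Submodule.le_div_iff_mul_le.1 le_rfl) <| by
    simpa using mul_le_mul_left (Submodule.one_le.2 (Submodule.one_mem_div.2 (le_refl I))) I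
  have hstab : I * ((I / I) / I) = I / I := h I hI
  refine ⟨(I / I) / I, fun h0 => ?_, by rw [mul_assoc, hstab, mul_comm, hmul]⟩
  have := IsStableIdeal.one_mem (h I hI)
  rw [h0, Submodule.mul_bot] at this
  exact one_ne_zero ((Submodule.mem_bot R).1 this)

theorem StableDomain.exists_mul_self_eq_smul [IsDomain R] [IsLocalRing R] [IsFractionRing R K]
    (h : StableDomain R K) {I : Submodule R K} (hI : IsFrac R K I) :
    ∃ x : K, x ≠ 0 ∧ I * I = x • I := by
  set H := (I / I) / I with hH
  obtain ⟨s, s', hs, hs', h1⟩ := Submodule.mem_span_mul_finite_of_mem_mul (h I hI).one_mem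
  set F := Submodule.span R (s : Set K)
  have hFI : F ≤ I := Submodule.span_le.2 hs
  have hFH : (1 : K) ∈ F * H := by
    rw [← Submodule.span_mul_span] at h1
    exact mul_le_mul_right (Submodule.span_le.2 hs') F h1
  have hF0 : F ≠ ⊥ := fun h0 => by
    rw [h0, Submodule.bot_mul] at hFH
    exact one_ne_zero ((Submodule.mem_bot R).1 hFH)
  have hFfg : F.FG := Submodule.fg_span s.finite_toSet
  obtain ⟨y, hyF, hy0, hy⟩ := (h F (.of_fg hFfg hF0)).exists_generator hFfg hF0
  have hII : (I / I) * I ≤ I := Submodule.le_div_iff_mul_le.1 le_rfl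
  have hHI : H * I ≤ I / I := Submodule.le_div_iff_mul_le.1 le_rfl
  have hmulI : ∀ e ∈ F / F, ∀ i ∈ I, e * i ∈ I := by
    intro e he i hi
    have key : ∀ x ∈ F * H, e * x * i ∈ I := fun x hx => by
      induction hx using Submodule.mul_induction_on' with
      | mem_mul_mem f hf g hg =>
        rw [show e * (f * g) * i = g * i * (e * f) by ring]
        exact hII (Submodule.mul_mem_mul (hHI (Submodule.mul_mem_mul hg hi))
          (hFI (Submodule.mem_div_iff_forall_mul_mem.1 he f hf)))
      | add a _ b _ ha hb => rw [mul_add, add_mul]; exact add_mem ha hb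
    simpa using key 1 hFH
  have hgen : ∀ i ∈ I, i * y⁻¹ ∈ I / I := by
    intro i hi
    refine Submodule.mem_div_iff_forall_mul_mem.2 fun j hj => ?_
    have key : ∀ x ∈ F * H, x * i * y⁻¹ * j ∈ I := fun x hx => by
      induction hx using Submodule.mul_induction_on' with
      | mem_mul_mem f hf g hg =>
        rw [show f * g * i * y⁻¹ * j = g * i * (f * y⁻¹ * j) by ring]
        exact hII (Submodule.mul_mem_mul (hHI (Submodule.mul_mem_mul hg hi))
          (hmulI _ (hy f hf) j hj))
      | add a _ b _ ha hb => simp only [add_mul]; exact add_mem ha hb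
    simpa using key 1 hFH
  refine ⟨y, hy0, le_antisymm (Submodule.mul_le.2 fun i hi j hj => ?_) ?_⟩
  · refine (Submodule.mem_smul_pointwise_iff_exists _ _ _).2
      ⟨_, Submodule.mem_div_iff_forall_mul_mem.1 (hgen i hi) j hj, ?_⟩
    rw [smul_eq_mul]
    field_simp
  · intro x hx
    obtain ⟨i, hi, rfl⟩ := (Submodule.mem_smul_pointwise_iff_exists _ _ _).1 hx
    exact Submodule.mul_mem_mul (hFI hyF) hi

theorem CliffordRegularDomain.of_mul_self_eq_smul
    (h : ∀ I : Submodule R K, IsFrac R K I → ∃ x : K, x ≠ 0 ∧ I * I = x • I) :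
    CliffordRegularDomain R K := by
  intro I hI
  obtain ⟨x, hx0, hx⟩ := h I hI
  refine ⟨Submodule.span R {x⁻¹}, by simpa using hx0, ?_⟩
  rw [hx]
  ext i
  simp only [Submodule.mem_mul_span_singleton, Submodule.mem_smul_pointwise_iff_exists]
  constructor
  · exact fun hi => ⟨x * i, ⟨i, hi, rfl⟩, by field_simp⟩
  · rintro ⟨_, ⟨j, hj, rfl⟩, rfl⟩
    rwa [smul_eq_mul, mul_comm x j, mul_inv_cancel_right₀ hx0]

end Clifford

/-- Let `R` be a local one-dimensional Mori domain (ascending chain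
condition on integral divisorial ideals). Then the following are equivalent:
(i) `R` is Clifford regular; (ii) `R` is stable; (iii) `R` is Boole regular. -/
theorem local_one_dim_mori_clifford_iff_stable_iff_boole
    {R K : Type*} [CommRing R] [IsDomain R] [Field K] [Algebra R K] [IsFractionRing R K]
    (M : Ideal R) (hM : M.IsMaximal) (hM0 : M ≠ ⊥)
    (hdim : ∀ P : Ideal R, P.IsPrime → P ≠ ⊥ → P = M)
    (hmori : ∀ f : ℕ → Ideal R, Monotone f →
      (∀ n, vS R K (idealK R K (f n)) = idealK R K (f n)) →
      ∃ n, ∀ m, n ≤ m → f m = f n) :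
    (CliffordRegularDomain R K ↔ StableDomain R K) ∧
      (StableDomain R K ↔
        ∀ I : Submodule R K, IsFrac R K I → ∃ x : K, x ≠ 0 ∧ I * I = x • I) := by
  have hloc : IsLocalRing R := .of_unique_max_ideal ⟨M, hM, fun N hN => hdim N hN.isPrime <| by
    rintro rfl
    exact hM0 (hN.eq_of_le hM.ne_top bot_le).symm⟩
  have hdim' : ∀ P : Ideal R, P.IsPrime → P ≠ ⊥ → P = IsLocalRing.maximalIdeal R := fun P hP hP0 =>
    (hdim P hP hP0).trans (IsLocalRing.eq_maximalIdeal hM)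
  have hCS : CliffordRegularDomain R K → StableDomain R K := fun h => h.stableDomain hdim' hmori
  exact ⟨⟨hCS, StableDomain.cliffordRegularDomain⟩,
    ⟨fun h _ hI => h.exists_mul_self_eq_smul hI,
      fun h => hCS (CliffordRegularDomain.of_mul_self_eq_smul h)⟩⟩
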